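/- Let p ∈ [2,∞), λ ∈ (0, 2/p), Λ > 0, η := 2/(λp) − 1 and ρ := (1−λ) p (1+η), and suppose the interpolation inequality ‖w‖_{V₂} ≤ Λ ‖w‖_{V₁}^λ |w|^{1−λ} holds for all w ∈ V. Then there is a constant c, depending only on Λ, p and λ, such that for every measure space (Ω, 𝔉, P), every T > 0 and every map v : [0,T] × Ω → V for which the functions (s,ω) ↦ ‖v(s,ω)‖_{V₁}, (s,ω) ↦ ‖v(s,ω)‖_{V₂}, (s,ω) ↦ |v(s,ω)| and ω ↦ sup_{s∈[0,T]} |v(s,ω)| are measurable, one has E ∫_0^T ‖v(s)‖_{V₂}^{p(1+η)} ds ≤ c [ E sup_{s∈[0,T]} |v(s)|^{2ρ} + E ( ∫_0^T ‖v(s)‖_{V₁}² ds )² ]. -/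

import Mathlib

open MeasureTheory

theorem ENNReal.mul_le_sq_add_sq (a b : ENNReal) : a * b ≤ a ^ 2 + b ^ 2 := by
  rcases le_total a b with h | h
  · calc a * b ≤ b * b := by gcongr
      _ = b ^ 2 := (sq b).symm
      _ ≤ a ^ 2 + b ^ 2 := le_add_self
  · calc a * b ≤ a * a := by gcongr
      _ = a ^ 2 := (sq a).symm
      _ ≤ a ^ 2 + b ^ 2 := le_self_add

theorem Real.rpow_two_div_le_of_interpolation {x y z lam Lam : ℝ} (hx : 0 ≤ x) (hy : 0 ≤ y)
    (hz : 0 ≤ z) (hlam : 0 < lam) (hLam : 0 ≤ Lam) (h : y ≤ Lam * x ^ lam * z ^ (1 - lam)) :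
    y ^ (2 / lam) ≤ Lam ^ (2 / lam) * z ^ ((1 - lam) * (2 / lam)) * x ^ (2 : ℝ) := by
  calc y ^ (2 / lam) ≤ (Lam * x ^ lam * z ^ (1 - lam)) ^ (2 / lam) :=
        Real.rpow_le_rpow hy h (by positivity)
    _ = Lam ^ (2 / lam) * x ^ (lam * (2 / lam)) * z ^ ((1 - lam) * (2 / lam)) := by
        rw [Real.mul_rpow (by positivity) (by positivity), Real.mul_rpow hLam (by positivity),
          ← Real.rpow_mul hx, ← Real.rpow_mul hz]
    _ = Lam ^ (2 / lam) * z ^ ((1 - lam) * (2 / lam)) * x ^ (2 : ℝ) := by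
        rw [mul_div_cancel₀ 2 hlam.ne']
        ring

/-- Under the interpolation inequality `‖w‖_{V₂} ≤ Λ ‖w‖_{V₁}^λ |w|^{1−λ}` with
`λ ∈ (0, 2/p)`, `η := 2/(λp) − 1` and `ρ := (1−λ)p(1+η)`, there is a constant `c`
depending only on `Λ`, `p` and `λ` such that for every measure space `(Ω, 𝔉, P)`,
every `T > 0` and every suitably measurable `v : [0,T] × Ω → V`,
`E ∫_0^T ‖v(s)‖_{V₂}^{p(1+η)} ds ≤ c [ E sup_{s ≤ T} |v(s)|^{2ρ} + E (∫_0^T ‖v(s)‖_{V₁}² ds)² ]`. -/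
theorem interpolation_expectation_bound
    {V : Type*} (nV₁ nV₂ nH : V → ℝ)
    (hnV₁ : ∀ v, 0 ≤ nV₁ v) (hnV₂ : ∀ v, 0 ≤ nV₂ v) (hnH : ∀ v, 0 ≤ nH v)
    (p lam Lam η ρ : ℝ) (hp : 2 ≤ p) (hlam : lam ∈ Set.Ioo 0 (2 / p)) (hLam : 0 < Lam)
    (hη : η = 2 / (lam * p) - 1) (hρ : ρ = (1 - lam) * p * (1 + η))
    (hinterp : ∀ w : V, nV₂ w ≤ Lam * nV₁ w ^ lam * nH w ^ (1 - lam)) :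
    ∃ c : ℝ, 0 < c ∧
      ∀ (Ω : Type) [MeasurableSpace Ω], ∀ (P : Measure Ω) (T : ℝ), 0 < T →
      ∀ v : ℝ → Ω → V,
        Measurable (fun q : ℝ × Ω => nV₁ (v q.1 q.2)) →
        Measurable (fun q : ℝ × Ω => nV₂ (v q.1 q.2)) →
        Measurable (fun q : ℝ × Ω => nH (v q.1 q.2)) →
        Measurable (fun ω : Ω => ⨆ s ∈ Set.Icc (0:ℝ) T, nH (v s ω)) →
        ∫⁻ ω, (∫⁻ s in Set.Ioc (0:ℝ) T, ENNReal.ofReal (nV₂ (v s ω) ^ (p * (1 + η)))) ∂P ≤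
          ENNReal.ofReal c *
            ((∫⁻ ω, (⨆ s ∈ Set.Icc (0:ℝ) T, ENNReal.ofReal (nH (v s ω))) ^ (2 * ρ) ∂P) +
              ∫⁻ ω, (∫⁻ s in Set.Ioc (0:ℝ) T, ENNReal.ofReal (nV₁ (v s ω) ^ (2:ℝ))) ^ (2:ℕ) ∂P) := by
  obtain ⟨hlam0, hlam1⟩ := hlam
  have hp0 : 0 < p := by linarith
  have hlam_lt : lam < 1 := hlam1.trans_le ((div_le_one hp0).2 hp)
  have hexp : p * (1 + η) = 2 / lam := by
    rw [hη]
    field_simp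
    ring
  have hρ' : ρ = (1 - lam) * (2 / lam) := by rw [hρ, mul_assoc, hexp]
  have hρ0 : 0 ≤ ρ := by
    rw [hρ']
    exact mul_nonneg (by linarith) (by positivity)
  have hC : 0 < Lam ^ (2 / lam) := by positivity
  refine ⟨Lam ^ (2 / lam), hC, fun Ω _ P T _ v hv₁ _ _ _ => ?_⟩
  have hm : Measurable fun q : ℝ × Ω => ENNReal.ofReal (nV₁ (v q.1 q.2) ^ (2 : ℝ)) :=
    (hv₁.pow_const _).ennreal_ofReal
  rw [← lintegral_add_right _ (hm.lintegral_prod_left'.pow_const 2),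
    ← lintegral_const_mul' _ _ ENNReal.ofReal_ne_top]
  refine lintegral_mono fun ω => ?_
  set S := ⨆ s ∈ Set.Icc (0 : ℝ) T, ENNReal.ofReal (nH (v s ω))
  set I := ∫⁻ s in Set.Ioc (0 : ℝ) T, ENNReal.ofReal (nV₁ (v s ω) ^ (2 : ℝ))
  calc ∫⁻ s in Set.Ioc (0 : ℝ) T, ENNReal.ofReal (nV₂ (v s ω) ^ (p * (1 + η)))
      ≤ ∫⁻ s in Set.Ioc (0 : ℝ) T, ENNReal.ofReal (Lam ^ (2 / lam)) * S ^ ρ *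
          ENNReal.ofReal (nV₁ (v s ω) ^ (2 : ℝ)) := by
        refine setLIntegral_mono' measurableSet_Ioc fun s hs => ?_
        have hS : ENNReal.ofReal (nH (v s ω)) ≤ S :=
          le_iSup₂ (f := fun s _ => ENNReal.ofReal (nH (v s ω))) s (Set.Ioc_subset_Icc_self hs)
        have hpt := Real.rpow_two_div_le_of_interpolation (hnV₁ (v s ω)) (hnV₂ (v s ω))
          (hnH (v s ω)) hlam0 hLam.le (hinterp (v s ω))
        rw [← hρ'] at hpt
        have hH : 0 ≤ nH (v s ω) ^ ρ := Real.rpow_nonneg (hnH _) _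
        rw [hexp]
        refine (ENNReal.ofReal_le_ofReal hpt).trans ?_
        rw [ENNReal.ofReal_mul (mul_nonneg hC.le hH), ENNReal.ofReal_mul hC.le,
          ← ENNReal.ofReal_rpow_of_nonneg (hnH _) hρ0]
        gcongr
    _ = ENNReal.ofReal (Lam ^ (2 / lam)) * (S ^ ρ * I) := by
        rw [← mul_assoc]
        exact lintegral_const_mul _ (hm.comp measurable_prodMk_right)
    _ ≤ ENNReal.ofReal (Lam ^ (2 / lam)) * (S ^ (2 * ρ) + I ^ 2) := by
        gcongr
        refine (ENNReal.mul_le_sq_add_sq _ _).trans_eq ?_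
        rw [← ENNReal.rpow_mul_natCast, mul_comm ρ]
        norm_num
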